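/- (Convergence of the bit-metric to the bit-channel mutual information in probability, in density.) Let W be a BI-DMC with finite output alphabet. For n ≥ 0 and N = 2ⁿ, let U be uniform on {0,1}^N, X = U·F_N over 𝔽₂ where F_N = F^{⊗n} with F = [[1,0],[1,1]], let Y be the output of N independent uses of W on X, and let Φ_{N,i} = log₂(P(Y, U^{i−1} | U_i) / P(Y, U^{i−1})) with mean I(W_N^{(i)}) = E[Φ_{N,i}]. Then for every δ > 0, (1/2ⁿ)·#{ i ∈ {1,…,2ⁿ} : P(|Φ_{2ⁿ,i} − I(W_{2ⁿ}^{(i)})| ≥ δ) > δ } → 0 as n → ∞. -/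

import Mathlib

open Finset Real

/-- Arıkan's kernel `F = [[1,0],[1,1]]` over `𝔽₂`. -/
def Fmat : Matrix (Fin 2) (Fin 2) (ZMod 2) := !![1, 0; 1, 1]

/-- The `n`-th Kronecker power `F_N = F^{⊗n}` (an `N×N` matrix with `N = 2ⁿ`),
with indices reindexed along `Fin (2ⁿ) × Fin 2 ≃ Fin (2^(n+1))`. -/
def FN : (n : ℕ) → Matrix (Fin (2 ^ n)) (Fin (2 ^ n)) (ZMod 2)
  | 0 => 1
  | n + 1 =>
      Matrix.reindex (finProdFinEquiv.trans (finCongr (pow_succ 2 n).symm))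
        (finProdFinEquiv.trans (finCongr (pow_succ 2 n).symm))
        (Matrix.kroneckerMap (· * ·) (FN n) Fmat)

/-- The polar encoding `x = u·F_N` over `𝔽₂`. -/
def polarEnc (n : ℕ) (u : Fin (2 ^ n) → ZMod 2) : Fin (2 ^ n) → ZMod 2 :=
  Matrix.vecMul u (FN n)

/-- The joint law of `(U, Y)` where `U` is uniform on `{0,1}^N`, `X = U·F_N`, and `Y` is
the output of `N` independent uses of the BI-DMC `W` on `X`:
`P(U=u, Y=y) = (1/2)^N · Π_j W(y_j | x_j)`. -/
noncomputable def Pjoint {Y : Type*} [Fintype Y] (W : ZMod 2 → Y → ℝ) (n : ℕ)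
    (u : Fin (2 ^ n) → ZMod 2) (y : Fin (2 ^ n) → Y) : ℝ :=
  ((1 : ℝ) / 2) ^ (2 ^ n) * ∏ j, W (polarEnc n u j) (y j)

/-- The joint law `P(Y = y, U^{i−1} = u^{i−1}, U_i = b)` of the output, the first `i−1`
inputs, and the `i`-th input (evaluated at the prefix of `u`). -/
noncomputable def Ajoint {Y : Type*} [Fintype Y] (W : ZMod 2 → Y → ℝ) (n : ℕ)
    (i : Fin (2 ^ n)) (b : ZMod 2) (u : Fin (2 ^ n) → ZMod 2) (y : Fin (2 ^ n) → Y) : ℝ :=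
  ∑ v ∈ Finset.univ.filter
      (fun v : Fin (2 ^ n) → ZMod 2 => v i = b ∧ ∀ j, j < i → v j = u j),
    Pjoint W n v y

/-- The marginal law `P(U_i = b)` (it equals `1/2`). -/
noncomputable def PUi (n : ℕ) (i : Fin (2 ^ n)) (b : ZMod 2) : ℝ :=
  ∑ _v ∈ Finset.univ.filter (fun v : Fin (2 ^ n) → ZMod 2 => v i = b),
    ((1 : ℝ) / 2) ^ (2 ^ n)

/-- The marginal law `P(Y = y, U^{i−1} = u^{i−1})`. -/
noncomputable def Pmarg {Y : Type*} [Fintype Y] (W : ZMod 2 → Y → ℝ) (n : ℕ)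
    (i : Fin (2 ^ n)) (u : Fin (2 ^ n) → ZMod 2) (y : Fin (2 ^ n) → Y) : ℝ :=
  ∑ b : ZMod 2, Ajoint W n i b u y

/-- The `i`-th bit-metric random variable
`Φ_{N,i} = log₂( P(Y, U^{i−1} | U_i) / P(Y, U^{i−1}) )`, as a function of the outcome
`(u, y)`. -/
noncomputable def bitMetric {Y : Type*} [Fintype Y] (W : ZMod 2 → Y → ℝ) (n : ℕ)
    (i : Fin (2 ^ n)) (u : Fin (2 ^ n) → ZMod 2) (y : Fin (2 ^ n) → Y) : ℝ :=
  Real.logb 2 ((Ajoint W n i (u i) u y / PUi n i (u i)) / Pmarg W n i u y)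

/-- The mean `E[Φ_{N,i}]` of the `i`-th bit metric. -/
noncomputable def bitMetricMean {Y : Type*} [Fintype Y] (W : ZMod 2 → Y → ℝ) (n : ℕ)
    (i : Fin (2 ^ n)) : ℝ :=
  ∑ u : Fin (2 ^ n) → ZMod 2, ∑ y : Fin (2 ^ n) → Y,
    Pjoint W n u y * bitMetric W n i u y

/-- The variance `Var(Φ_{N,i}) = E[Φ_{N,i}²] − E[Φ_{N,i}]²` of the `i`-th bit metric. -/
noncomputable def bitMetricVar {Y : Type*} [Fintype Y] (W : ZMod 2 → Y → ℝ) (n : ℕ)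
    (i : Fin (2 ^ n)) : ℝ :=
  (∑ u : Fin (2 ^ n) → ZMod 2, ∑ y : Fin (2 ^ n) → Y,
      Pjoint W n u y * bitMetric W n i u y ^ 2) - bitMetricMean W n i ^ 2

/-- The deviation probability `P(|Φ_{N,i} − I(W_N^{(i)})| ≥ δ)` of the `i`-th bit metric
from its mean `I(W_N^{(i)}) = E[Φ_{N,i}]`. -/
noncomputable def bitMetricDevProb {Y : Type*} [Fintype Y] (W : ZMod 2 → Y → ℝ) (n : ℕ)
    (i : Fin (2 ^ n)) (δ : ℝ) : ℝ :=
  ∑ u : Fin (2 ^ n) → ZMod 2, ∑ y : Fin (2 ^ n) → Y,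
    if δ ≤ |bitMetric W n i u y - bitMetricMean W n i| then Pjoint W n u y else 0

namespace PolarAux

lemma sumZ (f : ZMod 2 → ℝ) : ∑ b : ZMod 2, f b = f 0 + f 1 := Fin.sum_univ_two f

lemma zcases (b : ZMod 2) : b = 0 ∨ b = 1 := by
  revert b; decide

/-! ### Analytic inequalities -/

lemma x_log_sq {x : ℝ} (hx : 0 < x) : x * (Real.log x) ^ 2 ≤ (1 - x) ^ 2 := by
  set s := Real.sqrt x with hs
  have hs0 : 0 < s := Real.sqrt_pos.mpr hx
  have hxs : x = s ^ 2 := (Real.sq_sqrt hx.le).symm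
  have key : ∀ r : ℝ, 1 ≤ r → r * Real.log (r ^ 2) ≤ r ^ 2 - 1 := by
    intro r hr
    have hmono : MonotoneOn (fun r : ℝ => r - r⁻¹ - 2 * Real.log r) (Set.Ici 1) := by
      apply monotoneOn_of_deriv_nonneg (convex_Ici 1)
      · apply ContinuousOn.sub
        · apply ContinuousOn.sub continuousOn_id
          apply ContinuousOn.inv₀ continuousOn_id
          intro x hx; simp at hx ⊢; linarith
        · apply ContinuousOn.mul continuousOn_const
          apply ContinuousOn.log continuousOn_id
          intro x hx; simp at hx ⊢; linarith
      · intro x hx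
        simp at hx
        have hx0 : x ≠ 0 := by linarith
        exact (((differentiableAt_id).sub (differentiableAt_inv hx0)).sub
          ((Real.differentiableAt_log hx0).const_mul 2)).differentiableWithinAt
      · intro x hx
        simp at hx
        have hx0 : x ≠ 0 := by linarith
        have h : HasDerivAt (fun r : ℝ => r - r⁻¹ - 2 * Real.log r)
            (1 - (-(x ^ 2)⁻¹) - 2 * x⁻¹) x :=
          ((hasDerivAt_id x).sub (hasDerivAt_inv hx0)).sub
            ((Real.hasDerivAt_log hx0).const_mul 2)
        rw [h.deriv]
        have : 1 - (-(x ^ 2)⁻¹) - 2 * x⁻¹ = (1 - x⁻¹) ^ 2 := by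
          rw [← inv_pow]; ring
        rw [this]; positivity
    have h1 := hmono (Set.mem_Ici.mpr le_rfl) (Set.mem_Ici.mpr hr) hr
    simp at h1
    have hr0 : 0 < r := by linarith
    rw [Real.log_pow]
    have h2 : 2 * Real.log r ≤ r - r⁻¹ := by linarith
    have h3 := mul_le_mul_of_nonneg_left h2 hr0.le
    have h4 : r * (r - r⁻¹) = r ^ 2 - 1 := by field_simp
    push_cast
    linarith
  rcases le_total 1 s with h | h
  · have h1 := key s h
    have h2 : 0 ≤ s * Real.log (s ^ 2) :=
      mul_nonneg hs0.le (Real.log_nonneg (by nlinarith))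
    rw [hxs]
    have h3 := pow_le_pow_left₀ h2 h1 2
    calc s ^ 2 * Real.log (s ^ 2) ^ 2 = (s * Real.log (s ^ 2)) ^ 2 := by ring
      _ ≤ _ := h3
      _ = _ := by ring
  · have hi : 1 ≤ s⁻¹ := (one_le_inv₀ hs0).mpr h
    have h1 := key s⁻¹ hi
    have h2 : 0 ≤ s⁻¹ * Real.log (s⁻¹ ^ 2) :=
      mul_nonneg (by positivity) (Real.log_nonneg (by nlinarith))
    have h3 := pow_le_pow_left₀ h2 h1 2
    rw [inv_pow, Real.log_inv] at h3
    rw [hxs]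
    have h5 := mul_le_mul_of_nonneg_left h3 (by positivity : (0:ℝ) ≤ s ^ 4)
    have e1 : s ^ 4 * (s⁻¹ * -Real.log (s ^ 2)) ^ 2 = s ^ 2 * Real.log (s ^ 2) ^ 2 := by
      field_simp
    have e2 : s ^ 4 * ((s ^ 2)⁻¹ - 1) ^ 2 = (1 - s ^ 2) ^ 2 := by
      field_simp
    linarith

lemma t_log_sq {t : ℝ} (ht : 0 < t) (ht1 : t ≤ 1) :
    t * (Real.log t) ^ 2 ≤ 16 * Real.sqrt (t * (1 - t)) := by
  -- with r = sqrt t : t log² t = 4 r · (r log² r) and r log² r ≤ (1 - r)²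
  set r := Real.sqrt t with hr
  have hr0 : 0 < r := Real.sqrt_pos.mpr ht
  have htr : t = r ^ 2 := (Real.sq_sqrt ht.le).symm
  have hr1 : r ≤ 1 := by rw [hr]; exact Real.sqrt_le_one.mpr ht1
  have h1 := x_log_sq hr0
  rw [Real.sqrt_mul ht.le, ← hr]
  have h2 : (1 - r) ^ 2 ≤ Real.sqrt (1 - t) := by
    apply Real.le_sqrt_of_sq_le
    rw [htr]
    have : (1 - r) ^ 2 ≤ 1 := by nlinarith
    have h0 : 0 ≤ (1 - r) ^ 2 := sq_nonneg _
    nlinarith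
  have h3 : Real.log t = 2 * Real.log r := by rw [htr, Real.log_pow]; norm_num
  have hs : 0 ≤ Real.sqrt (1 - t) := Real.sqrt_nonneg _
  have h4 : r * (r * Real.log r ^ 2) ≤ r * Real.sqrt (1 - t) :=
    mul_le_mul_of_nonneg_left (h1.trans h2) hr0.le
  have h5 : 0 ≤ r * Real.sqrt (1 - t) := by positivity
  rw [h3, htr] at *
  nlinarith

lemma bound_one {a b : ℝ} (ha : 0 ≤ a) (hb : 0 ≤ b) :
    a * (Real.logb 2 (a / (1 / 2) / (a + b)) - 1) ^ 2
      ≤ 16 / (Real.log 2) ^ 2 * Real.sqrt (a * b) := by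
  rcases ha.eq_or_lt with h | h
  · rw [← h]; simp
  have hl : 0 < Real.log 2 := Real.log_pos (by norm_num)
  have hab : 0 < a + b := by linarith
  set t := a / (a + b) with ht
  have ht0 : 0 < t := by positivity
  have ht1 : t ≤ 1 := by rw [ht, div_le_one hab]; linarith
  have e1 : a / (1 / 2) / (a + b) = 2 * t := by rw [ht]; field_simp
  have e2 : Real.logb 2 (2 * t) - 1 = Real.log t / Real.log 2 := by
    unfold Real.logb
    rw [Real.log_mul (by norm_num) ht0.ne']
    field_simp; ring
  rw [e1, e2]
  have h1 := mul_le_mul_of_nonneg_left (t_log_sq ht0 ht1) hab.le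
  have e3 : (a + b) * Real.sqrt (t * (1 - t)) = Real.sqrt (a * b) := by
    have : a * b = (a + b) ^ 2 * (t * (1 - t)) := by rw [ht]; field_simp; ring
    rw [this, Real.sqrt_mul (sq_nonneg _), Real.sqrt_sq hab.le]
  have e4 : (a + b) * t = a := by rw [ht]; field_simp
  have h2 : a * Real.log t ^ 2 ≤ 16 * Real.sqrt (a * b) := by
    calc a * Real.log t ^ 2 = (a + b) * (t * Real.log t ^ 2) := by rw [← mul_assoc, e4]
      _ ≤ _ := h1
      _ = _ := by rw [← e3]; ring
  calc a * (Real.log t / Real.log 2) ^ 2 = (a * Real.log t ^ 2) / Real.log 2 ^ 2 := by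
        rw [div_pow]; ring
    _ ≤ (16 * Real.sqrt (a * b)) / Real.log 2 ^ 2 := by gcongr
    _ = _ := by ring

lemma bound_zero {a b : ℝ} (ha : 0 ≤ a) (hb : 0 ≤ b) :
    a * (Real.logb 2 (a / (1 / 2) / (a + b)) - 0) ^ 2
      ≤ 1 / (Real.log 2) ^ 2 * (a + b - 2 * Real.sqrt (a * b)) := by
  have hl : 0 < Real.log 2 := Real.log_pos (by norm_num)
  rcases ha.eq_or_lt with h | h
  · rw [← h]; simp; positivity
  have hab : 0 < a + b := by linarith
  set x := 2 * a / (a + b) with hx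
  have hx0 : 0 < x := by positivity
  have e1 : a / (1 / 2) / (a + b) = x := by rw [hx]; field_simp
  rw [e1, sub_zero]
  unfold Real.logb
  have h1 := mul_le_mul_of_nonneg_left (x_log_sq hx0) (by positivity : 0 ≤ (a + b) / 2)
  have e4 : (a + b) / 2 * x = a := by rw [hx]; field_simp
  have h2 : a * Real.log x ^ 2 ≤ (a + b) / 2 * (1 - x) ^ 2 := by
    calc a * Real.log x ^ 2 = (a + b) / 2 * (x * Real.log x ^ 2) := by rw [← mul_assoc, e4]
      _ ≤ _ := h1
  have h3 : (a + b) / 2 * (1 - x) ^ 2 ≤ a + b - 2 * Real.sqrt (a * b) := by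
    have e : (a + b) / 2 * (1 - x) ^ 2 = (a - b) ^ 2 / (2 * (a + b)) := by
      rw [hx]; field_simp; ring
    rw [e, div_le_iff₀ (by positivity), Real.sqrt_mul ha]
    obtain ⟨p, hp⟩ : ∃ p, p = Real.sqrt a := ⟨_, rfl⟩
    obtain ⟨q, hq⟩ : ∃ q, q = Real.sqrt b := ⟨_, rfl⟩
    have hpa : a = p ^ 2 := by rw [hp, Real.sq_sqrt ha]
    have hqb : b = q ^ 2 := by rw [hq, Real.sq_sqrt hb]
    rw [← hp, ← hq, hpa, hqb]
    have : (p ^ 2 + q ^ 2 - 2 * (p * q)) * (2 * (p ^ 2 + q ^ 2)) - (p ^ 2 - q ^ 2) ^ 2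
        = ((p - q) ^ 2) ^ 2 := by ring
    nlinarith [sq_nonneg ((p - q) ^ 2)]
  calc a * (Real.log x / Real.log 2) ^ 2 = (a * Real.log x ^ 2) / Real.log 2 ^ 2 := by
        rw [div_pow]; ring
    _ ≤ (a + b - 2 * Real.sqrt (a * b)) / Real.log 2 ^ 2 := by gcongr; exact h2.trans h3
    _ = _ := by ring

lemma minus_ineq {a0 a1 c0 c1 : ℝ} (h0 : 0 ≤ a0) (h1 : 0 ≤ a1) (k0 : 0 ≤ c0) (k1 : 0 ≤ c1) :
    Real.sqrt ((a0 * c0 + a1 * c1) * (a1 * c0 + a0 * c1)) ≤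
      Real.sqrt (a0 * a1) * (c0 + c1) + (a0 + a1) * Real.sqrt (c0 * c1)
        - 2 * (Real.sqrt (a0 * a1) * Real.sqrt (c0 * c1)) := by
  rw [Real.sqrt_mul h0, Real.sqrt_mul k0]
  obtain ⟨p, hp⟩ : ∃ p, p = Real.sqrt a0 := ⟨_, rfl⟩
  obtain ⟨q, hq⟩ : ∃ q, q = Real.sqrt a1 := ⟨_, rfl⟩
  obtain ⟨r, hr⟩ : ∃ r, r = Real.sqrt c0 := ⟨_, rfl⟩
  obtain ⟨s, hs⟩ : ∃ s, s = Real.sqrt c1 := ⟨_, rfl⟩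
  have e0 : a0 = p ^ 2 := by rw [hp, Real.sq_sqrt h0]
  have e1 : a1 = q ^ 2 := by rw [hq, Real.sq_sqrt h1]
  have f0 : c0 = r ^ 2 := by rw [hr, Real.sq_sqrt k0]
  have f1 : c1 = s ^ 2 := by rw [hs, Real.sq_sqrt k1]
  have p0 : 0 ≤ p := hp ▸ Real.sqrt_nonneg _
  have q0 : 0 ≤ q := hq ▸ Real.sqrt_nonneg _
  have r0 : 0 ≤ r := hr ▸ Real.sqrt_nonneg _
  have s0 : 0 ≤ s := hs ▸ Real.sqrt_nonneg _
  rw [← hp, ← hq, ← hr, ← hs, e0, e1, f0, f1]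
  have pq : 0 ≤ p * q := mul_nonneg p0 q0
  have rs : 0 ≤ r * s := mul_nonneg r0 s0
  apply Real.sqrt_le_iff.mpr
  constructor
  · have : p * q * (r ^ 2 + s ^ 2) + (p ^ 2 + q ^ 2) * (r * s) - 2 * (p * q * (r * s))
      = p * q * (r - s) ^ 2 + (p ^ 2 + q ^ 2) * (r * s) := by ring
    rw [this]; positivity
  · have : (p * q * (r ^ 2 + s ^ 2) + (p ^ 2 + q ^ 2) * (r * s) - 2 * (p * q * (r * s))) ^ 2
      = (p ^ 2 * r ^ 2 + q ^ 2 * s ^ 2) * (q ^ 2 * r ^ 2 + p ^ 2 * s ^ 2)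
        + 2 * ((p * q) * (r * s)) * ((p - q) ^ 2 * (r - s) ^ 2) := by ring
    rw [this]
    have : 0 ≤ 2 * ((p * q) * (r * s)) * ((p - q) ^ 2 * (r - s) ^ 2) := by positivity
    linarith

/-! ### Index splitting -/

/-- index splitting `(i, a) ↦ 2 i + a`. -/
def ee (n : ℕ) : Fin (2 ^ n) × Fin 2 ≃ Fin (2 ^ (n + 1)) :=
  finProdFinEquiv.trans (finCongr (pow_succ 2 n).symm)

lemma ee_val (n : ℕ) (i : Fin (2 ^ n)) (a : Fin 2) :
    (ee n (i, a)).val = a.val + 2 * i.val := rfl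

/-- interleaving of two vectors -/
def vv {α : Type*} (n : ℕ) : ((Fin (2 ^ n) → α) × (Fin (2 ^ n) → α)) ≃ (Fin (2 ^ (n + 1)) → α) where
  toFun p := fun k => if ((ee n).symm k).2 = 0 then p.1 ((ee n).symm k).1 else p.2 ((ee n).symm k).1
  invFun w := (fun i => w (ee n (i, 0)), fun i => w (ee n (i, 1)))
  left_inv p := by simp
  right_inv w := by
    funext k
    obtain ⟨⟨i, a⟩, rfl⟩ := (ee n).surjective k
    fin_cases a <;> simp

lemma vv_zero {α : Type*} (n : ℕ) (p : (Fin (2 ^ n) → α) × (Fin (2 ^ n) → α)) (i) :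
    vv n p (ee n (i, 0)) = p.1 i := by simp [vv]
lemma vv_one {α : Type*} (n : ℕ) (p : (Fin (2 ^ n) → α) × (Fin (2 ^ n) → α)) (i) :
    vv n p (ee n (i, 1)) = p.2 i := by simp [vv]

lemma zadd (a : ZMod 2) : a + a = 0 := by revert a; decide

/-- `(s,t) ↦ (s+t, t)` -/
def shear (n : ℕ) : ((Fin (2 ^ n) → ZMod 2) × (Fin (2 ^ n) → ZMod 2)) ≃
    ((Fin (2 ^ n) → ZMod 2) × (Fin (2 ^ n) → ZMod 2)) where
  toFun p := (p.1 + p.2, p.2)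
  invFun p := (p.1 + p.2, p.2)
  left_inv p := by
    ext i
    · simp [add_assoc, zadd]
    · simp
  right_inv p := by
    ext i
    · simp [add_assoc, zadd]
    · simp

/-- input vector with branch vectors `s`, `t`. -/
def uu (n : ℕ) : ((Fin (2 ^ n) → ZMod 2) × (Fin (2 ^ n) → ZMod 2)) ≃
    (Fin (2 ^ (n + 1)) → ZMod 2) := (shear n).trans (vv n)

lemma uu_zero (n : ℕ) (s t : Fin (2 ^ n) → ZMod 2) (i) :
    uu n (s, t) (ee n (i, 0)) = s i + t i := by simp [uu, vv_zero, shear]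
lemma uu_one (n : ℕ) (s t : Fin (2 ^ n) → ZMod 2) (i) :
    uu n (s, t) (ee n (i, 1)) = t i := by simp [uu, vv_one, shear]

lemma FN_succ (n : ℕ) (i j : Fin (2 ^ n)) (a b : Fin 2) :
    FN (n + 1) (ee n (i, a)) (ee n (j, b)) = FN n i j * Fmat a b := by
  simp only [FN, Matrix.reindex_apply, Matrix.submatrix_apply, ee, Equiv.symm_apply_apply,
    Matrix.kroneckerMap_apply]

lemma enc_succ (n : ℕ) (s t : Fin (2 ^ n) → ZMod 2) :
    polarEnc (n + 1) (uu n (s, t)) = vv n (polarEnc n s, polarEnc n t) := by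
  funext k
  obtain ⟨⟨j, b⟩, rfl⟩ := (ee n).surjective k
  unfold polarEnc
  simp only [Matrix.vecMul, dotProduct]
  rw [← (ee n).sum_comp, Fintype.sum_prod_type]
  simp only [Fin.sum_univ_two, FN_succ, uu_zero, uu_one]
  fin_cases b
  · simp only [Fin.zero_eta, vv_zero]
    apply Finset.sum_congr rfl
    intro x _
    simp [Fmat]
    rw [add_mul, add_assoc, zadd, add_zero]
  · simp only [Fin.mk_one, vv_one]
    apply Finset.sum_congr rfl
    intro x _
    simp [Fmat]

section
variable {Y : Type*} [Fintype Y] (W : ZMod 2 → Y → ℝ)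

lemma Pjoint_succ (n : ℕ) (s t : Fin (2 ^ n) → ZMod 2) (y z : Fin (2 ^ n) → Y) :
    Pjoint W (n + 1) (uu n (s, t)) (vv n (y, z)) = Pjoint W n s y * Pjoint W n t z := by
  unfold Pjoint
  rw [enc_succ, ← (ee n).prod_comp, Fintype.prod_prod_type]
  simp only [Fin.prod_univ_two, vv_zero, vv_one, Finset.prod_mul_distrib]
  rw [pow_succ 2 n, mul_two, pow_add]
  ring

lemma Ajoint_ite (n : ℕ) (i : Fin (2 ^ n)) (b : ZMod 2) (u : Fin (2 ^ n) → ZMod 2)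
    (y : Fin (2 ^ n) → Y) :
    Ajoint W n i b u y = ∑ v, if (v i = b ∧ ∀ j, j < i → v j = u j) then Pjoint W n v y else 0 := by
  unfold Ajoint; rw [Finset.sum_filter]

lemma pre_zero (n : ℕ) (i : Fin (2 ^ n)) (s t s' t' : Fin (2 ^ n) → ZMod 2) :
    (∀ k, k < ee n (i, 0) → uu n (s', t') k = uu n (s, t) k) ↔
      (∀ j, j < i → s' j = s j) ∧ (∀ j, j < i → t' j = t j) := by
  constructor
  · intro h
    have ht : ∀ j, j < i → t' j = t j := by
      intro j hj
      have := h (ee n (j, 1)) (by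
        rw [Fin.lt_def] at *; rw [ee_val, ee_val]; simp; omega)
      rwa [uu_one, uu_one] at this
    refine ⟨?_, ht⟩
    intro j hj
    have := h (ee n (j, 0)) (by
        rw [Fin.lt_def] at *; rw [ee_val, ee_val]; simp; omega)
    rw [uu_zero, uu_zero, ht j hj] at this
    exact add_right_cancel this
  · rintro ⟨h1, h2⟩ k hk
    obtain ⟨⟨j, a⟩, rfl⟩ := (ee n).surjective k
    have hj : j < i := by
      rw [Fin.lt_def] at *; rw [ee_val, ee_val] at hk; simp at hk; omega
    fin_cases a
    · simp only [Fin.zero_eta, uu_zero, h1 j hj, h2 j hj]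
    · simp only [Fin.mk_one, uu_one, h2 j hj]

lemma pre_one (n : ℕ) (i : Fin (2 ^ n)) (s t s' t' : Fin (2 ^ n) → ZMod 2) :
    (∀ k, k < ee n (i, 1) → uu n (s', t') k = uu n (s, t) k) ↔
      ((∀ j, j < i → s' j = s j) ∧ (∀ j, j < i → t' j = t j)) ∧ s' i + t' i = s i + t i := by
  rw [← pre_zero]
  constructor
  · intro h
    refine ⟨fun k hk => h k (hk.trans ?_), ?_⟩
    · rw [Fin.lt_def, ee_val, ee_val]; simp
    · have := h (ee n (i, 0)) (by rw [Fin.lt_def, ee_val, ee_val]; simp)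
      rwa [uu_zero, uu_zero] at this
  · rintro ⟨h1, h2⟩ k hk
    by_cases hk0 : k < ee n (i, 0)
    · exact h1 k hk0
    · have : k = ee n (i, 0) := by
        ext
        rw [Fin.lt_def] at *; rw [ee_val] at *; simp at *; omega
      rw [this, uu_zero, uu_zero, h2]

lemma ite_mul_ite {P Q R : Prop} [Decidable P] [Decidable Q] [Decidable R] (a b : ℝ)
    (h : R ↔ P ∧ Q) :
    (if P then a else 0) * (if Q then b else 0) = if R then a * b else 0 := by
  by_cases hP : P <;> by_cases hQ : Q <;> simp [h, hP, hQ]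

lemma A_zero (n : ℕ) (i : Fin (2 ^ n)) (b : ZMod 2) (s t : Fin (2 ^ n) → ZMod 2)
    (y z : Fin (2 ^ n) → Y) :
    Ajoint W (n + 1) (ee n (i, 0)) b (uu n (s, t)) (vv n (y, z)) =
      ∑ c : ZMod 2, Ajoint W n i (b + c) s y * Ajoint W n i c t z := by
  rw [Ajoint_ite, ← (uu n).sum_comp, Fintype.sum_prod_type]
  simp only [Ajoint_ite W n, Finset.sum_mul_sum]
  symm
  rw [Finset.sum_comm]
  refine Finset.sum_congr rfl fun s' _ => ?_
  rw [Finset.sum_comm]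
  refine Finset.sum_congr rfl fun t' _ => ?_
  rw [Finset.sum_eq_single (t' i)]
  · simp only [Pjoint_succ, uu_zero, pre_zero]
    have : s' i + t' i = b ↔ s' i = b + t' i := by
      constructor
      · intro h; rw [← h, add_assoc, zadd, add_zero]
      · intro h; rw [h, add_assoc, zadd, add_zero]
    apply ite_mul_ite
    rw [this]
    tauto
  · intro c _ hc
    rw [if_neg (c := t' i = c ∧ _) (fun h => hc h.1.symm), mul_zero]
  · simp

lemma A_one (n : ℕ) (i : Fin (2 ^ n)) (c : ZMod 2) (s t : Fin (2 ^ n) → ZMod 2)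
    (y z : Fin (2 ^ n) → Y) :
    Ajoint W (n + 1) (ee n (i, 1)) c (uu n (s, t)) (vv n (y, z)) =
      Ajoint W n i (s i + t i + c) s y * Ajoint W n i c t z := by
  rw [Ajoint_ite, ← (uu n).sum_comp, Fintype.sum_prod_type]
  simp only [Ajoint_ite W n, Finset.sum_mul_sum]
  refine Finset.sum_congr rfl fun s' _ => ?_
  refine Finset.sum_congr rfl fun t' _ => ?_
  simp only [Pjoint_succ, uu_one, pre_one]
  symm
  apply ite_mul_ite
  by_cases h0 : t' i = c
  · have : s' i + t' i = s i + t i ↔ s' i = s i + t i + c := by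
      rw [h0]
      constructor
      · intro h; rw [← h, add_assoc, zadd, add_zero]
      · intro h; rw [h, add_assoc, zadd, add_zero]
    rw [this]
    tauto
  · tauto

/-! ### Weights and expectations -/

/-- weight of one full vector relative to its prefix class -/
noncomputable def wt (n : ℕ) (i : Fin (2 ^ n)) : ℝ := (1 / 2 : ℝ) ^ (2 ^ n - i.val)

lemma wt_zero (n : ℕ) (i : Fin (2 ^ n)) : wt (n + 1) (ee n (i, 0)) = wt n i ^ 2 := by
  unfold wt
  rw [← pow_mul, ee_val, pow_succ 2 n]
  congr 1
  simp; omega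

lemma wt_one (n : ℕ) (i : Fin (2 ^ n)) : wt (n + 1) (ee n (i, 1)) = 2 * wt n i ^ 2 := by
  unfold wt
  rw [← pow_mul, ee_val, pow_succ 2 n]
  have : (2 ^ n - i.val) * 2 = (2 ^ n * 2 - ((1 : Fin 2).val + 2 * i.val)) + 1 := by
    have := i.isLt
    simp; omega
  rw [this, pow_succ]; ring

lemma wt_nonneg (n : ℕ) (i : Fin (2 ^ n)) : 0 ≤ wt n i := by unfold wt; positivity

lemma count_pre (N : ℕ) (i : Fin N) (v : Fin N → ZMod 2) :
    (univ.filter (fun u : Fin N → ZMod 2 => ∀ j, j < i → v j = u j)).card = 2 ^ (N - i.val) := by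
  have : (univ.filter (fun u : Fin N → ZMod 2 => ∀ j, j < i → v j = u j)) =
      Fintype.piFinset (fun j => if j < i then {v j} else univ) := by
    ext u
    simp only [mem_filter, mem_univ, true_and, Fintype.mem_piFinset]
    refine forall_congr' fun j => ?_
    by_cases h : j < i <;> simp [h, eq_comm]
  rw [this, Fintype.card_piFinset]
  have h2 : ∀ j, (if j < i then ({v j} : Finset (ZMod 2)) else univ).card = if i ≤ j then 2 else 1 := by
    intro j
    by_cases h : j < i
    · simp [h, not_le.mpr h]
    · simp [h, not_lt.mp h, ZMod.card]
  simp only [h2]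
  rw [Finset.prod_ite]
  simp only [prod_const, one_pow, mul_one]
  rw [← Fin.card_Ici]
  congr 2
  ext j; simp

lemma PUi_eq (n : ℕ) (i : Fin (2 ^ n)) (b : ZMod 2) : PUi n i b = 1 / 2 := by
  unfold PUi
  have : (univ.filter (fun u : Fin (2 ^ n) → ZMod 2 => u i = b)) =
      Fintype.piFinset (fun j => if j = i then {b} else univ) := by
    ext u
    simp only [mem_filter, mem_univ, true_and, Fintype.mem_piFinset]
    constructor
    · intro h j
      by_cases hj : j = i
      · subst hj; simp [h]
      · simp [hj]
    · intro h; simpa using h i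
  rw [sum_const, this, Fintype.card_piFinset]
  have h2 : ∀ j, (if j = i then ({b} : Finset (ZMod 2)) else univ).card = if j = i then 1 else 2 := by
    intro j
    by_cases h : j = i
    · simp [h]
    · simp [h, ZMod.card]
  simp only [h2]
  rw [Finset.prod_ite]
  simp only [prod_const, one_pow, one_mul]
  have h3 : (univ.filter (fun j : Fin (2 ^ n) => ¬ j = i)).card = 2 ^ n - 1 := by
    rw [Finset.filter_not, Finset.filter_eq' univ i]
    simp [Finset.card_sdiff]
  rw [h3]
  obtain ⟨m, hm⟩ : ∃ m, 2 ^ n = m + 1 := ⟨2 ^ n - 1, by have := Nat.one_le_two_pow (n := n); omega⟩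
  rw [hm]
  simp [pow_succ]

lemma A_congr (n : ℕ) (i : Fin (2 ^ n)) (b : ZMod 2) (u v : Fin (2 ^ n) → ZMod 2)
    (y : Fin (2 ^ n) → Y) (h : ∀ j, j < i → v j = u j) :
    Ajoint W n i b v y = Ajoint W n i b u y := by
  unfold Ajoint
  congr 1
  ext w
  simp only [mem_filter, mem_univ, true_and]
  refine and_congr_right fun _ => forall_congr' fun j => forall_congr' fun hj => ?_
  rw [h j hj]

lemma expect (n : ℕ) (i : Fin (2 ^ n)) (f : ZMod 2 → ℝ → ℝ → ℝ) :
    ∑ u, ∑ y, Pjoint W n u y * f (u i) (Ajoint W n i 0 u y) (Ajoint W n i 1 u y) =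
    wt n i * ∑ u, ∑ y, ∑ b, Ajoint W n i b u y * f b (Ajoint W n i 0 u y) (Ajoint W n i 1 u y) := by
  have h1 : ∀ u y, ∑ b, Ajoint W n i b u y * f b (Ajoint W n i 0 u y) (Ajoint W n i 1 u y) =
      ∑ v, if (∀ j, j < i → v j = u j) then
        Pjoint W n v y * f (v i) (Ajoint W n i 0 v y) (Ajoint W n i 1 v y) else 0 := by
    intro u y
    simp only [Finset.sum_mul, Ajoint_ite W n i _ u y]
    simp only [← Ajoint_ite W n i _ u y]
    rw [Finset.sum_comm]
    refine Finset.sum_congr rfl fun v _ => ?_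
    rw [Finset.sum_eq_single (v i)]
    · by_cases h : ∀ j, j < i → v j = u j
      · rw [if_pos ⟨rfl, h⟩, if_pos h, A_congr W n i 0 u v y h, A_congr W n i 1 u v y h]
      · rw [if_neg h, if_neg (fun h' => h h'.2), zero_mul]
    · intro c _ hc
      rw [if_neg (fun h => hc h.1.symm), zero_mul]
    · simp
  simp only [h1]
  have h2 : ∑ u : Fin (2 ^ n) → ZMod 2, ∑ y, ∑ v : Fin (2 ^ n) → ZMod 2, (if (∀ j, j < i → v j = u j) then
        Pjoint W n v y * f (v i) (Ajoint W n i 0 v y) (Ajoint W n i 1 v y) else 0) =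
      ∑ v : Fin (2 ^ n) → ZMod 2, ∑ y, (2 : ℝ) ^ (2 ^ n - i.val) *
        (Pjoint W n v y * f (v i) (Ajoint W n i 0 v y) (Ajoint W n i 1 v y)) := by
    have h3 : ∀ u : Fin (2 ^ n) → ZMod 2, ∑ y, ∑ v, (if (∀ j, j < i → v j = u j) then
        Pjoint W n v y * f (v i) (Ajoint W n i 0 v y) (Ajoint W n i 1 v y) else 0) =
        ∑ v, ∑ y, (if (∀ j, j < i → v j = u j) then
        Pjoint W n v y * f (v i) (Ajoint W n i 0 v y) (Ajoint W n i 1 v y) else 0) :=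
      fun u => Finset.sum_comm
    simp only [h3]
    rw [Finset.sum_comm]
    refine Finset.sum_congr rfl fun v _ => ?_
    rw [Finset.sum_comm]
    refine Finset.sum_congr rfl fun y _ => ?_
    rw [← Finset.sum_filter, Finset.sum_const, count_pre, nsmul_eq_mul]
    push_cast; rfl
  rw [h2]
  simp only [← Finset.mul_sum]
  rw [← mul_assoc]
  have : wt n i * 2 ^ (2 ^ n - i.val) = 1 := by
    unfold wt; rw [← mul_pow]; norm_num
  rw [this, one_mul]


lemma P_nonneg (hW0 : ∀ x y, 0 ≤ W x y)
    (n : ℕ) (u : Fin (2 ^ n) → ZMod 2) (y : Fin (2 ^ n) → Y) : 0 ≤ Pjoint W n u y := by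
  unfold Pjoint
  exact mul_nonneg (by positivity) (Finset.prod_nonneg fun j _ => hW0 _ _)

lemma A_nonneg (hW0 : ∀ x y, 0 ≤ W x y)
    (n : ℕ) (i : Fin (2 ^ n)) (b : ZMod 2) (u : Fin (2 ^ n) → ZMod 2)
    (y : Fin (2 ^ n) → Y) : 0 ≤ Ajoint W n i b u y :=
  Finset.sum_nonneg fun _ _ => P_nonneg W hW0 n _ _


lemma P_total (hW1 : ∀ x, ∑ y : Y, W x y = 1)
    (n : ℕ) : ∑ u, ∑ y, Pjoint W n u y = 1 := by
  unfold Pjoint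
  have : ∀ u : Fin (2 ^ n) → ZMod 2, ∑ y : Fin (2 ^ n) → Y,
      (1 / 2 : ℝ) ^ 2 ^ n * ∏ j, W (polarEnc n u j) (y j) = (1 / 2 : ℝ) ^ 2 ^ n := by
    intro u
    rw [← Finset.mul_sum, ← Fintype.prod_sum (f := fun j y => W (polarEnc n u j) y)]
    simp [hW1]
  simp only [this]
  rw [Finset.sum_const, Finset.card_univ, Fintype.card_fun, ZMod.card, Fintype.card_fin,
    nsmul_eq_mul]
  push_cast
  rw [← mul_pow]; norm_num

lemma A_total (hW1 : ∀ x, ∑ y : Y, W x y = 1)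
    (n : ℕ) (i : Fin (2 ^ n)) :
    wt n i * ∑ u, ∑ y, (Ajoint W n i 0 u y + Ajoint W n i 1 u y) = 1 := by
  have h := expect W n i (fun _ _ _ => 1)
  simp only [mul_one, sumZ] at h
  rw [← h, P_total W hW1]


/-- Bhattacharyya parameter of the bit channel -/
noncomputable def Zb (n : ℕ) (i : Fin (2 ^ n)) : ℝ :=
  wt n i * ∑ u, ∑ y, 2 * Real.sqrt (Ajoint W n i 0 u y * Ajoint W n i 1 u y)

lemma Zb_nonneg (n : ℕ) (i : Fin (2 ^ n)) : 0 ≤ Zb W n i :=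
  mul_nonneg (wt_nonneg n i) (Finset.sum_nonneg fun _ _ => Finset.sum_nonneg fun _ _ => by positivity)

lemma sum_split (n : ℕ) (g : (Fin (2 ^ (n + 1)) → ZMod 2) → (Fin (2 ^ (n + 1)) → Y) → ℝ) :
    ∑ u, ∑ y, g u y = ∑ s, ∑ y, ∑ t, ∑ z, g (uu n (s, t)) (vv n (y, z)) := by
  rw [← (uu n).sum_comp, Fintype.sum_prod_type]
  refine Finset.sum_congr rfl fun s _ => ?_
  rw [Finset.sum_comm]
  rw [← (vv n).sum_comp, Fintype.sum_prod_type]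
  refine Finset.sum_congr rfl fun y _ => ?_
  rw [Finset.sum_comm]

lemma sum4_mul (n : ℕ) (F G : (Fin (2 ^ n) → ZMod 2) → (Fin (2 ^ n) → Y) → ℝ) :
    ∑ s, ∑ y, ∑ t, ∑ z, F s y * G t z = (∑ s, ∑ y, F s y) * (∑ t, ∑ z, G t z) := by
  simp only [← Finset.mul_sum, ← Finset.sum_mul]


lemma Zb_one (hW0 : ∀ x y, 0 ≤ W x y)
    (n : ℕ) (i : Fin (2 ^ n)) : Zb W (n + 1) (ee n (i, 1)) = Zb W n i ^ 2 := by
  have h : ∀ s t y z, 2 * Real.sqrt (Ajoint W (n + 1) (ee n (i, 1)) 0 (uu n (s, t)) (vv n (y, z))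
      * Ajoint W (n + 1) (ee n (i, 1)) 1 (uu n (s, t)) (vv n (y, z))) =
      Real.sqrt (Ajoint W n i 0 s y * Ajoint W n i 1 s y) *
      (2 * Real.sqrt (Ajoint W n i 0 t z * Ajoint W n i 1 t z)) := by
    intro s t y z
    rw [A_one, A_one]
    have e : Ajoint W n i (s i + t i + 0) s y * Ajoint W n i (s i + t i + 1) s y =
        Ajoint W n i 0 s y * Ajoint W n i 1 s y := by
      rcases zcases (s i + t i) with h | h
      · rw [h]; simp
      · rw [h, zadd]; simp [mul_comm]
    rw [mul_mul_mul_comm, e, Real.sqrt_mul (mul_nonneg (A_nonneg W hW0 ..) (A_nonneg W hW0 ..))]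
    ring
  unfold Zb
  rw [sum_split]
  simp only [h]
  rw [sum4_mul, wt_one]
  simp only [← Finset.mul_sum]
  ring


lemma Zb_zero (hW0 : ∀ x y, 0 ≤ W x y) (hW1 : ∀ x, ∑ y : Y, W x y = 1)
    (n : ℕ) (i : Fin (2 ^ n)) :
    Zb W (n + 1) (ee n (i, 0)) ≤ 2 * Zb W n i - Zb W n i ^ 2 := by
  set q : (Fin (2 ^ n) → ZMod 2) → (Fin (2 ^ n) → Y) → ℝ :=
    fun u y => 2 * Real.sqrt (Ajoint W n i 0 u y * Ajoint W n i 1 u y) with hq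
  set p : (Fin (2 ^ n) → ZMod 2) → (Fin (2 ^ n) → Y) → ℝ :=
    fun u y => Ajoint W n i 0 u y + Ajoint W n i 1 u y with hp
  have h : ∀ s t y z, 2 * Real.sqrt (Ajoint W (n + 1) (ee n (i, 0)) 0 (uu n (s, t)) (vv n (y, z))
      * Ajoint W (n + 1) (ee n (i, 0)) 1 (uu n (s, t)) (vv n (y, z))) ≤
      q s y * p t z + p s y * q t z - q s y * q t z := by
    intro s t y z
    rw [A_zero, A_zero, sumZ, sumZ]
    have e : (1 + 1 : ZMod 2) = 0 := by decide
    simp only [add_zero, zero_add, e]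
    have := minus_ineq (A_nonneg W hW0 n i 0 s y) (A_nonneg W hW0 n i 1 s y)
      (A_nonneg W hW0 n i 0 t z) (A_nonneg W hW0 n i 1 t z)
    simp only [hq, hp]
    linarith
  have hZ : Zb W n i = wt n i * ∑ s, ∑ y, q s y := rfl
  have hT : wt n i * ∑ s, ∑ y, p s y = 1 := A_total W hW1 n i
  have h2 : Zb W (n + 1) (ee n (i, 0)) ≤ wt (n + 1) (ee n (i, 0)) *
      ∑ s, ∑ y, ∑ t, ∑ z, (q s y * p t z + p s y * q t z - q s y * q t z) := by
    unfold Zb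
    rw [sum_split]
    apply mul_le_mul_of_nonneg_left _ (wt_nonneg _ _)
    exact Finset.sum_le_sum fun s _ => Finset.sum_le_sum fun y _ =>
      Finset.sum_le_sum fun t _ => Finset.sum_le_sum fun z _ => h s t y z
  refine h2.trans (le_of_eq ?_)
  simp only [Finset.sum_sub_distrib, Finset.sum_add_distrib]
  rw [sum4_mul, sum4_mul, sum4_mul, wt_zero, hZ]
  set Q := ∑ s, ∑ y, q s y
  set P := ∑ s, ∑ y, p s y
  linear_combination 2 * (wt n i * Q) * hT

lemma Zb_le_one (hW0 : ∀ x y, 0 ≤ W x y) (hW1 : ∀ x, ∑ y : Y, W x y = 1)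
    (n : ℕ) (i : Fin (2 ^ n)) : Zb W n i ≤ 1 := by
  rw [← A_total W hW1 n i]
  unfold Zb
  apply mul_le_mul_of_nonneg_left _ (wt_nonneg _ _)
  refine Finset.sum_le_sum fun u _ => Finset.sum_le_sum fun y _ => ?_
  have h0 := A_nonneg W hW0 n i 0 u y
  have h1 := A_nonneg W hW0 n i 1 u y
  rw [Real.sqrt_mul h0]
  nlinarith [Real.sq_sqrt h0, Real.sq_sqrt h1,
    sq_nonneg (Real.sqrt (Ajoint W n i 0 u y) - Real.sqrt (Ajoint W n i 1 u y))]

/-- second moment about `c` -/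
lemma second_moment (hW0 : ∀ x y, 0 ≤ W x y)
    (n : ℕ) (i : Fin (2 ^ n)) (c : ℝ) (G : ℝ → ℝ → ℝ)
    (hG : ∀ a b, G a b = G b a)
    (h : ∀ a b : ℝ, 0 ≤ a → 0 ≤ b → a * (Real.logb 2 (a / (1 / 2) / (a + b)) - c) ^ 2 ≤ G a b) :
    ∑ u, ∑ y, Pjoint W n u y * (bitMetric W n i u y - c) ^ 2 ≤
      wt n i * ∑ u, ∑ y, 2 * G (Ajoint W n i 0 u y) (Ajoint W n i 1 u y) := by
  have e : ∀ u y, bitMetric W n i u y = (fun b a0 a1 =>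
      Real.logb 2 ((if b = (0 : ZMod 2) then a0 else a1) / (1 / 2) / (a0 + a1)))
        (u i) (Ajoint W n i 0 u y) (Ajoint W n i 1 u y) := by
    intro u y
    unfold bitMetric Pmarg
    rw [PUi_eq, sumZ]
    rcases zcases (u i) with h | h <;> simp [h]
  simp only [e]
  have := expect W n i (fun b a0 a1 =>
    (Real.logb 2 ((if b = (0 : ZMod 2) then a0 else a1) / (1 / 2) / (a0 + a1)) - c) ^ 2)
  rw [this]
  apply mul_le_mul_of_nonneg_left _ (wt_nonneg _ _)
  refine Finset.sum_le_sum fun u _ => Finset.sum_le_sum fun y _ => ?_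
  rw [sumZ]
  have h0 := A_nonneg W hW0 n i 0 u y
  have h1 := A_nonneg W hW0 n i 1 u y
  have k0 := h _ _ h0 h1
  have k1 := h _ _ h1 h0
  rw [hG, add_comm (Ajoint W n i 1 u y)] at k1
  simp only [if_true, one_ne_zero, if_false]
  linarith

lemma moment_one (hW0 : ∀ x y, 0 ≤ W x y) (hW1 : ∀ x, ∑ y : Y, W x y = 1)
    (n : ℕ) (i : Fin (2 ^ n)) :
    ∑ u, ∑ y, Pjoint W n u y * (bitMetric W n i u y - 1) ^ 2 ≤ 16 / (Real.log 2) ^ 2 * Zb W n i := by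
  refine (second_moment W hW0 n i 1 (fun a b => 16 / (Real.log 2) ^ 2 * Real.sqrt (a * b))
    (fun a b => by rw [mul_comm a b]) (fun a b => bound_one)).trans (le_of_eq ?_)
  unfold Zb
  simp only [← Finset.mul_sum]
  ring

lemma moment_zero (hW0 : ∀ x y, 0 ≤ W x y) (hW1 : ∀ x, ∑ y : Y, W x y = 1)
    (n : ℕ) (i : Fin (2 ^ n)) :
    ∑ u, ∑ y, Pjoint W n u y * (bitMetric W n i u y - 0) ^ 2 ≤
      16 / (Real.log 2) ^ 2 * (1 - Zb W n i) := by
  have h1 := second_moment W hW0 n i 0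
    (fun a b => 1 / (Real.log 2) ^ 2 * (a + b - 2 * Real.sqrt (a * b)))
    (fun a b => by rw [mul_comm a b, add_comm a b]) (fun a b => bound_zero)
  have h2 := A_total W hW1 n i
  have h3 : wt n i * ∑ u, ∑ y, 2 * (1 / (Real.log 2) ^ 2 *
      (Ajoint W n i 0 u y + Ajoint W n i 1 u y
        - 2 * Real.sqrt (Ajoint W n i 0 u y * Ajoint W n i 1 u y)))
      = 2 / (Real.log 2) ^ 2 * (1 - Zb W n i) := by
    unfold Zb
    simp only [← Finset.mul_sum, Finset.sum_sub_distrib]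
    linear_combination (2 / (Real.log 2) ^ 2) * h2
  refine h1.trans (h3.le.trans ?_)
  have := Zb_le_one W hW0 hW1 n i
  have hl : 0 < Real.log 2 := Real.log_pos (by norm_num)
  apply mul_le_mul_of_nonneg_right _ (by linarith)
  gcongr; norm_num

lemma dev_le (hW0 : ∀ x y, 0 ≤ W x y) (hW1 : ∀ x, ∑ y : Y, W x y = 1)
    (n : ℕ) (i : Fin (2 ^ n)) (δ : ℝ) (hδ : 0 < δ) (c : ℝ) :
    δ ^ 2 * bitMetricDevProb W n i δ ≤ ∑ u, ∑ y, Pjoint W n u y * (bitMetric W n i u y - c) ^ 2 := by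
  set m := bitMetricMean W n i with hm
  have h1 : δ ^ 2 * bitMetricDevProb W n i δ ≤
      ∑ u, ∑ y, Pjoint W n u y * (bitMetric W n i u y - m) ^ 2 := by
    unfold bitMetricDevProb
    rw [← hm]
    simp only [Finset.mul_sum]
    refine Finset.sum_le_sum fun u _ => Finset.sum_le_sum fun y _ => ?_
    have hP := P_nonneg W hW0 n u y
    split_ifs with h
    · have := pow_le_pow_left₀ hδ.le h 2
      rw [sq_abs] at this
      nlinarith
    · rw [mul_zero]; positivity
  have h2 : ∑ u, ∑ y, Pjoint W n u y * (bitMetric W n i u y - c) ^ 2 =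
      ∑ u, ∑ y, Pjoint W n u y * (bitMetric W n i u y - m) ^ 2 + (m - c) ^ 2 := by
    have e : ∀ u y, Pjoint W n u y * (bitMetric W n i u y - c) ^ 2 =
        Pjoint W n u y * (bitMetric W n i u y - m) ^ 2
        + (2 * (m - c)) * (Pjoint W n u y * bitMetric W n i u y)
        + ((m - c) ^ 2 - 2 * (m - c) * m) * Pjoint W n u y := by intros; ring
    simp only [e, Finset.sum_add_distrib, ← Finset.mul_sum]
    rw [P_total W hW1]
    have : ∑ u, ∑ y, Pjoint W n u y * bitMetric W n i u y = m := rfl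
    rw [this]; ring
  rw [h2]
  nlinarith [sq_nonneg (m - c)]

lemma dev_bound (hW0 : ∀ x y, 0 ≤ W x y) (hW1 : ∀ x, ∑ y : Y, W x y = 1)
    (n : ℕ) (i : Fin (2 ^ n)) (δ : ℝ) (hδ : 0 < δ) :
    δ ^ 2 * bitMetricDevProb W n i δ ≤
      32 / (Real.log 2) ^ 2 * (Zb W n i * (1 - Zb W n i)) := by
  have h0 := (dev_le W hW0 hW1 n i δ hδ 0).trans (moment_zero W hW0 hW1 n i)
  have h1 := (dev_le W hW0 hW1 n i δ hδ 1).trans (moment_one W hW0 hW1 n i)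
  have hz0 := Zb_nonneg W n i
  have hz1 := Zb_le_one W hW0 hW1 n i
  have hK : 0 ≤ 16 / (Real.log 2) ^ 2 := by positivity
  have e : 32 / (Real.log 2) ^ 2 = 2 * (16 / (Real.log 2) ^ 2) := by ring
  rw [e]
  set K := 16 / (Real.log 2) ^ 2
  set z := Zb W n i
  rcases le_total z (1 / 2) with h | h
  · refine h1.trans ?_
    nlinarith [mul_nonneg hK (mul_nonneg hz0 (by linarith : 0 ≤ 1 - 2 * z))]
  · refine h0.trans ?_
    nlinarith [mul_nonneg hK (mul_nonneg (by linarith : 0 ≤ 1 - z) (by linarith : 0 ≤ 2 * z - 1))]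

lemma potential (hW0 : ∀ x y, 0 ≤ W x y) (hW1 : ∀ x, ∑ y : Y, W x y = 1)
    (n : ℕ) :
    (∑ i, (Zb W n i * (1 - Zb W n i)) ^ 2) / 2 ^ n ≤
      (∑ k, (1 - Zb W (n + 1) k) ^ 2) / 2 ^ (n + 1) - (∑ i, (1 - Zb W n i) ^ 2) / 2 ^ n := by
  have h : ∑ i, (2 * (Zb W n i * (1 - Zb W n i)) ^ 2 + 2 * (1 - Zb W n i) ^ 2) ≤
      ∑ k, (1 - Zb W (n + 1) k) ^ 2 := by
    rw [← (ee n).sum_comp, Fintype.sum_prod_type]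
    refine Finset.sum_le_sum fun i _ => ?_
    rw [Fin.sum_univ_two, Zb_one W hW0]
    have h1 := Zb_zero W hW0 hW1 n i
    set z := Zb W n i
    have h2 : (1 - z) ^ 2 ≤ 1 - Zb W (n + 1) (ee n (i, 0)) := by nlinarith
    have h3 := pow_le_pow_left₀ (sq_nonneg _) h2 2
    nlinarith
  rw [Finset.sum_add_distrib, ← Finset.mul_sum, ← Finset.mul_sum] at h
  rw [le_sub_iff_add_le, ← add_div, div_le_div_iff₀ (by positivity) (by positivity), pow_succ]
  have : (0 : ℝ) < 2 ^ n := by positivity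
  nlinarith

lemma tendsto_T (hW0 : ∀ x y, 0 ≤ W x y) (hW1 : ∀ x, ∑ y : Y, W x y = 1)
    :
    Filter.Tendsto (fun n : ℕ => (∑ i, (Zb W n i * (1 - Zb W n i)) ^ 2) / 2 ^ n)
      Filter.atTop (nhds 0) := by
  set S : ℕ → ℝ := fun n => (∑ i, (1 - Zb W n i) ^ 2) / 2 ^ n with hS
  have hpos : ∀ n, 0 ≤ (∑ i, (Zb W n i * (1 - Zb W n i)) ^ 2) / 2 ^ n := fun n => by positivity
  have hstep := potential W hW0 hW1
  have hmono : Monotone S := monotone_nat_of_le_succ fun n => by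
    have := hstep n; have := hpos n; simp only [hS]; linarith
  have hbdd : BddAbove (Set.range S) := by
    refine ⟨1, ?_⟩
    rintro _ ⟨n, rfl⟩
    simp only [hS]
    rw [div_le_one (by positivity)]
    calc ∑ i, (1 - Zb W n i) ^ 2 ≤ ∑ i : Fin (2 ^ n), (1 : ℝ) := by
          refine Finset.sum_le_sum fun i _ => ?_
          have := Zb_nonneg W n i
          have := Zb_le_one W hW0 hW1 n i
          nlinarith
      _ = 2 ^ n := by simp
  have hlim := tendsto_atTop_ciSup hmono hbdd
  have hlim' := (Filter.tendsto_add_atTop_iff_nat 1).mpr hlim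
  have hd := hlim'.sub hlim
  rw [sub_self] at hd
  exact squeeze_zero hpos hstep hd

end

end PolarAux

/-- convergence of the bit metric to the bit-channel mutual information in
probability, in density: for every `δ > 0`, the fraction of indices `i ∈ {1,…,2ⁿ}` with
`P(|Φ_{2ⁿ,i} − I(W_{2ⁿ}^{(i)})| ≥ δ) > δ` tends to `0` as `n → ∞`. -/
theorem bit_metric_converges_in_probability_in_density
    {Y : Type*} [Fintype Y] (W : ZMod 2 → Y → ℝ)
    (hW0 : ∀ x y, 0 ≤ W x y) (hW1 : ∀ x, ∑ y : Y, W x y = 1)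
    (δ : ℝ) (hδ : 0 < δ) :
    Filter.Tendsto
      (fun n : ℕ =>
        ((Finset.univ.filter
            (fun i : Fin (2 ^ n) => δ < bitMetricDevProb W n i δ)).card : ℝ)
          / (2 ^ n : ℝ))
      Filter.atTop (nhds 0) := by
  have hT := PolarAux.tendsto_T W hW0 hW1
  set K : ℝ := 32 / (Real.log 2) ^ 2 with hK
  have hT' := hT.const_mul ((K / δ ^ 3) ^ 2)
  rw [mul_zero] at hT'
  refine squeeze_zero (fun n => by positivity) (fun n => ?_) hT'
  rw [← mul_div_assoc, Finset.mul_sum]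
  apply div_le_div_of_nonneg_right _ (by positivity)
  rw [Finset.card_filter]
  push_cast
  refine Finset.sum_le_sum fun i _ => ?_
  split_ifs with h
  · have h1 := PolarAux.dev_bound W hW0 hW1 n i δ hδ
    rw [← hK] at h1
    have h2 : δ ^ 3 ≤ K * (PolarAux.Zb W n i * (1 - PolarAux.Zb W n i)) := by
      refine le_trans ?_ h1
      have := mul_le_mul_of_nonneg_left h.le (sq_nonneg δ)
      calc δ ^ 3 = δ ^ 2 * δ := by ring
        _ ≤ _ := this
    have h3 : 1 ≤ K / δ ^ 3 * (PolarAux.Zb W n i * (1 - PolarAux.Zb W n i)) := by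
      rw [div_mul_eq_mul_div, one_le_div (by positivity)]
      exact h2
    have h4 := one_le_pow₀ h3 (n := 2)
    rwa [mul_pow] at h4
  · positivity
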